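/- Let d ≥ 1 and let ρ₀ be the unique r ∈ (0,1) with r/(1−r)² − r = 1. Then for every α > π·((1+ρ₀)^{1/d} − 1)^{−2}, the Gaussian potential V(z) = ‖z‖² satisfies β(V,α) < 1. (This gives the explicit bound α*(‖·‖²) ≤ π·((1+ρ₀)^{1/d} − 1)^{−2} ≈ π·(1.44504^{1/d} − 1)^{−2} on the critical temperature.) -/

import Mathlib

open scoped ENNReal

/-- The support of a permutation of `ℤ^d`. -/
def psupp {d : ℕ} (σ : Equiv.Perm (Fin d → ℤ)) : Set (Fin d → ℤ) := {x | σ x ≠ x}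

/-- A finite cycle of `ℤ^d`: a cycle with finite support. -/
def IsFiniteCycle {d : ℕ} (θ : Equiv.Perm (Fin d → ℤ)) : Prop :=
  θ.IsCycle ∧ (psupp θ).Finite

/-- The weight `w(θ) = exp(−α ∑_{x ∈ supp θ} V(θ(x) − x))` of a finite cycle. -/
noncomputable def w {d : ℕ} (V : (Fin d → ℤ) → ℝ) (α : ℝ)
    (θ : Equiv.Perm (Fin d → ℤ)) : ℝ :=
  Real.exp (-α * ∑ᶠ x ∈ psupp θ, V (θ x - x))

/-- `β(V,α) = ∑_{θ finite cycle, 0 ∈ supp θ} |θ| w(θ)`, summed in `[0,∞]`. -/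
noncomputable def beta {d : ℕ} (V : (Fin d → ℤ) → ℝ) (α : ℝ) : ℝ≥0∞ :=
  ∑' θ : {θ : Equiv.Perm (Fin d → ℤ) // IsFiniteCycle θ ∧ (0 : Fin d → ℤ) ∈ psupp θ},
    ((psupp θ.1).ncard : ℝ≥0∞) * ENNReal.ofReal (w V α θ.1)

theorem aux_tsum_pow {X : Type*} (g : X → ℝ≥0∞) (n : ℕ) :
    ∑' s : Fin n → X, ∏ k, g (s k) = (∑' x, g x) ^ n := by
  induction n with
  | zero => simp
  | succ n ih =>
    rw [← (Fin.consEquiv (fun _ : Fin (n + 1) => X)).tsum_eq, ENNReal.tsum_prod']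
    simp only [Fin.consEquiv, Equiv.coe_fn_mk, Fin.prod_univ_succ, Fin.cons_zero, Fin.cons_succ]
    simp only [ENNReal.tsum_mul_left]
    rw [ih, ENNReal.tsum_mul_right, pow_succ']

theorem aux_nat_gauss (α : ℝ) (hα : 0 < α) :
    ∑' n : ℕ, ENNReal.ofReal (Real.exp (-α * ((n : ℝ) + 1) ^ 2)) ≤
      ENNReal.ofReal (√(Real.pi / α) / 2) := by
  apply ENNReal.tsum_le_of_sum_range_le
  intro n
  rw [← ENNReal.ofReal_sum_of_nonneg (fun i _ => (Real.exp_pos _).le)]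
  apply ENNReal.ofReal_le_ofReal
  have h1 : AntitoneOn (fun x : ℝ => Real.exp (-α * x ^ 2)) (Set.Icc 0 (0 + (n : ℝ))) := by
    intro x hx y hy hxy
    apply Real.exp_le_exp.2
    have := hx.1
    have : x ^ 2 ≤ y ^ 2 := by gcongr
    nlinarith
  have h2 := h1.sum_le_integral
  have h3 := integral_gaussian_Ioi α
  have h4 : ∫ x in (0 : ℝ)..(0 + (n : ℝ)), Real.exp (-α * x ^ 2) ≤
      ∫ x in Set.Ioi (0 : ℝ), Real.exp (-α * x ^ 2) := by
    rw [intervalIntegral.integral_of_le (by simp)]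
    apply MeasureTheory.setIntegral_mono_set
    · exact (integrable_exp_neg_mul_sq hα).integrableOn
    · exact Filter.Eventually.of_forall fun x => (Real.exp_pos _).le
    · exact (Set.Ioc_subset_Ioi_self).eventuallyLE
  rw [h3] at h4
  refine le_trans (le_of_eq ?_) (h2.trans h4)
  apply Finset.sum_congr rfl
  intro i _
  simp

theorem aux_int_gauss (α : ℝ) (hα : 0 < α) :
    ∑' n : ℤ, ENNReal.ofReal (Real.exp (-α * (n : ℝ) ^ 2)) ≤
      ENNReal.ofReal (1 + √(Real.pi / α)) := by
  rw [tsum_of_add_one_of_neg_add_one ENNReal.summable ENNReal.summable]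
  have h := aux_nat_gauss α hα
  have e : (1 + √(Real.pi / α)) = √(Real.pi / α) / 2 + 1 + √(Real.pi / α) / 2 := by ring
  rw [e, ENNReal.ofReal_add (by positivity) (by positivity),
    ENNReal.ofReal_add (by positivity) (by positivity)]
  gcongr
  · refine le_trans (le_of_eq ?_) h
    simp
  · simp
  · refine le_trans (le_of_eq ?_) h
    apply tsum_congr
    intro n
    congr 3
    push_cast
    ring

/-- step weight, zero at the origin -/
noncomputable def stepW {d : ℕ} (α : ℝ) (z : Fin d → ℤ) : ℝ≥0∞ :=
  if z = 0 then 0 else ENNReal.ofReal (Real.exp (-α * ∑ i, ((z i : ℝ)) ^ 2))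

theorem aux_phi (d : ℕ) (α : ℝ) :
    1 + ∑' z : Fin d → ℤ, stepW α z =
      (∑' n : ℤ, ENNReal.ofReal (Real.exp (-α * (n : ℝ) ^ 2))) ^ d := by
  rw [← aux_tsum_pow]
  have : ∀ z : Fin d → ℤ, ∏ k, ENNReal.ofReal (Real.exp (-α * (z k : ℝ) ^ 2)) =
      (if z = 0 then 1 else 0) + stepW α z := by
    intro z
    rw [← ENNReal.ofReal_prod_of_nonneg (fun i _ => (Real.exp_pos _).le), ← Real.exp_sum,
      ← Finset.mul_sum, stepW]
    split_ifs with h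
    · simp [h]
    · simp
  simp_rw [this]
  rw [ENNReal.tsum_add, tsum_ite_eq]

theorem aux_phi_lt (d : ℕ) (hd : 1 ≤ d)
    (ρ₀ : ℝ) (h₀ : ρ₀ ∈ Set.Ioo (0 : ℝ) 1)
    (α : ℝ) (hα : Real.pi / ((1 + ρ₀) ^ ((1 : ℝ) / d) - 1) ^ 2 < α) :
    ∑' z : Fin d → ℤ, stepW α z < ENNReal.ofReal ρ₀ := by
  obtain ⟨hp, hl⟩ := h₀
  have hd' : (0 : ℝ) < d := by exact_mod_cast hd
  set c := (1 + ρ₀) ^ ((1 : ℝ) / d) with hc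
  have hc1 : 1 < c := Real.one_lt_rpow (by linarith) (by positivity)
  have hα0 : 0 < α := lt_of_le_of_lt (by positivity) hα
  have hs : √(Real.pi / α) < c - 1 := by
    rw [Real.sqrt_lt' (by linarith), div_lt_iff₀ hα0]
    rw [div_lt_iff₀ (by nlinarith)] at hα
    linarith
  have hcd : c ^ d = 1 + ρ₀ := by
    rw [hc, one_div, Real.rpow_inv_natCast_pow (by linarith) (by omega)]
  have key : 1 + ∑' z : Fin d → ℤ, stepW α z < 1 + ENNReal.ofReal ρ₀ := by
    rw [aux_phi]
    calc _ ≤ (ENNReal.ofReal (1 + √(Real.pi / α))) ^ d := by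
          gcongr; exact aux_int_gauss α hα0
      _ = ENNReal.ofReal ((1 + √(Real.pi / α)) ^ d) := by
          rw [ENNReal.ofReal_pow (by positivity)]
      _ < ENNReal.ofReal (c ^ d) := by
          rw [ENNReal.ofReal_lt_ofReal_iff (by positivity)]
          exact pow_lt_pow_left₀ (by linarith) (by positivity) (by omega)
      _ = _ := by
          rw [hcd, ENNReal.ofReal_add (by norm_num) hp.le, ENNReal.ofReal_one]
  exact (ENNReal.add_lt_add_iff_left (by simp)).1 key

theorem aux_real (ρ₀ r : ℝ) (hp : 0 < ρ₀) (hl : ρ₀ < 1) (hr0 : 0 ≤ r) (hr : r < ρ₀)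
    (heq : ρ₀ / (1 - ρ₀) ^ 2 - ρ₀ = 1) : r / (1 - r) ^ 2 - r < 1 := by
  have h1 : 0 < 1 - ρ₀ := by linarith
  have h2 : 0 < 1 - r := by linarith
  rw [sub_lt_iff_lt_add, div_lt_iff₀ (by positivity)]
  have h3 : ρ₀ = (1 + ρ₀) * (1 - ρ₀) ^ 2 := by
    rw [← div_eq_iff (by positivity)]; linarith
  have h4 : 0 < 2 + r + ρ₀ - r ^ 2 - r * ρ₀ - ρ₀ ^ 2 := by nlinarith
  nlinarith [mul_pos (sub_pos.2 hr) h4]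

theorem aux_hasSum (r : ℝ) (hr0 : 0 ≤ r) (hr : r < 1) :
    HasSum (fun n : ℕ => (n : ℝ) * r ^ n - if n = 1 then r else 0)
      (r / (1 - r) ^ 2 - r) := by
  have h1 : HasSum (fun n : ℕ => (n : ℝ) * r ^ n) (r / (1 - r) ^ 2) :=
    hasSum_coe_mul_geometric_of_norm_lt_one (by rw [Real.norm_of_nonneg hr0]; exact hr)
  have h2 : HasSum (fun n : ℕ => if n = 1 then r else 0) r := hasSum_ite_eq 1 r
  exact h1.sub h2

theorem aux_series (φ : ℝ≥0∞) (ρ₀ : ℝ) (h₀ : ρ₀ ∈ Set.Ioo (0 : ℝ) 1)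
    (heq : ρ₀ / (1 - ρ₀) ^ 2 - ρ₀ = 1) (h : φ < ENNReal.ofReal ρ₀) :
    ∑' n : ℕ, (if n = 1 then 0 else (n : ℝ≥0∞) * φ ^ n) < 1 := by
  obtain ⟨hp, hl⟩ := h₀
  obtain ⟨r, hr0, rfl⟩ : ∃ r : ℝ, 0 ≤ r ∧ φ = ENNReal.ofReal r :=
    ⟨φ.toReal, ENNReal.toReal_nonneg, (ENNReal.ofReal_toReal h.ne_top).symm⟩
  have hr : r < ρ₀ := (ENNReal.ofReal_lt_ofReal_iff hp).1 h
  have e : ∀ n : ℕ, (if n = 1 then 0 else (n : ℝ≥0∞) * (ENNReal.ofReal r) ^ n) =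
      ENNReal.ofReal ((n : ℝ) * r ^ n - if n = 1 then r else 0) := by
    intro n
    split_ifs with hn
    · simp [hn]
    · rw [sub_zero, ENNReal.ofReal_mul (by positivity), ENNReal.ofReal_pow hr0]
      simp
  have hs : HasSum (fun n : ℕ => (n : ℝ) * r ^ n - if n = 1 then r else 0)
      (r / (1 - r) ^ 2 - r) := aux_hasSum r hr0 (by linarith)
  simp_rw [e]
  rw [← ENNReal.ofReal_tsum_of_nonneg _ hs.summable, hs.tsum_eq, ENNReal.ofReal_lt_one]
  · exact aux_real ρ₀ r hp hl hr0 hr heq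
  · intro n
    split_ifs with hn
    · simp [hn]
    · simp; positivity

section cyc
variable {d : ℕ}

theorem aux_cyc (θ : Equiv.Perm (Fin d → ℤ)) (h : IsFiniteCycle θ)
    (h0 : (0 : Fin d → ℤ) ∈ psupp θ) :
    Set.BijOn (fun k : ℕ => (θ ^ k) 0) (Finset.range (psupp θ).ncard) (psupp θ) := by
  have hc : θ.IsCycleOn (psupp θ) := h.1.isCycleOn
  rw [Set.ncard_eq_toFinset_card _ h.2]
  have hc' : θ.IsCycleOn (h.2.toFinset : Set _) := by simpa using hc
  have h0' : (0 : Fin d → ℤ) ∈ h.2.toFinset := by simpa using h0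
  refine ⟨fun k _ => ?_, fun k hk l hl hkl => ?_, fun x hx => ?_⟩
  · exact hc.1.mapsTo.perm_pow _ h0
  · have := (hc'.pow_apply_eq_pow_apply h0').1 hkl
    rw [Finset.coe_range] at hk hl
    exact this.eq_of_lt_of_lt hk hl
  · obtain ⟨k, hk, e⟩ := hc'.exists_pow_eq h0' (b := x) (by simpa using hx)
    exact ⟨k, by simpa using hk, e⟩

theorem aux_weight (α : ℝ) (θ : Equiv.Perm (Fin d → ℤ)) (h : IsFiniteCycle θ)
    (h0 : (0 : Fin d → ℤ) ∈ psupp θ) :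
    ENNReal.ofReal (w (fun z : Fin d → ℤ => ∑ i, ((z i : ℝ)) ^ 2) α θ) =
      ∏ k : Fin (psupp θ).ncard, stepW α ((θ ^ (k.1 + 1)) 0 - (θ ^ k.1) 0) := by
  have hb := aux_cyc θ h h0
  have e1 : ∀ k : Fin (psupp θ).ncard, stepW α ((θ ^ (k.1 + 1)) 0 - (θ ^ k.1) 0) =
      ENNReal.ofReal (Real.exp (-α *
        ∑ i, ((((θ ^ (k.1 + 1)) 0 - (θ ^ k.1) 0) i : ℤ) : ℝ) ^ 2)) := by
    intro k
    have : (θ ^ k.1) 0 ∈ psupp θ := hb.mapsTo (by simp)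
    rw [stepW, if_neg]
    rw [sub_eq_zero, pow_succ', Equiv.Perm.mul_apply]
    exact this
  rw [Finset.prod_congr rfl (fun k _ => e1 k),
    ← ENNReal.ofReal_prod_of_nonneg (fun i _ => (Real.exp_pos _).le), ← Real.exp_sum,
      ← Finset.mul_sum, w]
  congr 3
  rw [Fin.sum_univ_eq_sum_range
    (fun k : ℕ => ∑ i, ((((θ ^ (k + 1)) 0 - (θ ^ k) 0) i : ℤ) : ℝ) ^ 2) (psupp θ).ncard,
    ← finsum_mem_coe_finset]
  refine (finsum_mem_eq_of_bijOn _ hb ?_).symm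
  intro k _
  simp [pow_succ']

theorem aux_pow_eq (θ τ : Equiv.Perm (Fin d → ℤ)) (n : ℕ)
    (h : ∀ k < n, (θ ^ (k + 1)) 0 - (θ ^ k) 0 = (τ ^ (k + 1)) 0 - (τ ^ k) 0) :
    ∀ k ≤ n, (θ ^ k) 0 = (τ ^ k) 0 := by
  intro k
  induction k with
  | zero => simp
  | succ k ih =>
    intro hk
    have := h k hk
    rw [ih (by omega)] at this
    exact sub_left_injective this

theorem aux_agree (θ τ : Equiv.Perm (Fin d → ℤ)) (hθ : IsFiniteCycle θ)
    (h0 : (0 : Fin d → ℤ) ∈ psupp θ)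
    (h : ∀ k ≤ (psupp θ).ncard, (θ ^ k) 0 = (τ ^ k) 0) (x : Fin d → ℤ) (hx : x ∈ psupp θ) :
    θ x = τ x := by
  obtain ⟨k, hk, rfl⟩ := (aux_cyc θ hθ h0).surjOn hx
  have hk' : k < (psupp θ).ncard := by simpa using hk
  have := h (k + 1) hk'
  simp only
  rw [pow_succ', pow_succ', Equiv.Perm.mul_apply, Equiv.Perm.mul_apply, ← h k hk'.le] at this
  exact this

/-- encode a cycle through 0 by its steps -/
noncomputable def enc (θ : {θ : Equiv.Perm (Fin d → ℤ) // IsFiniteCycle θ ∧ (0 : Fin d → ℤ) ∈ psupp θ}) :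
    Σ n : ℕ, (Fin n → (Fin d → ℤ)) :=
  ⟨(psupp θ.1).ncard, fun k => (θ.1 ^ (k.1 + 1)) 0 - (θ.1 ^ k.1) 0⟩

theorem aux_sigma {X : Type*} (n m : ℕ) (s t : ℕ → X)
    (h : (⟨n, fun k => s k.1⟩ : Σ n : ℕ, (Fin n → X)) = ⟨m, fun k => t k.1⟩) :
    n = m ∧ ∀ k < n, s k = t k := by
  obtain ⟨rfl, h2⟩ := Sigma.mk.inj_iff.1 h
  exact ⟨rfl, fun k hk => congrFun (eq_of_heq h2) ⟨k, hk⟩⟩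

theorem enc_injective : Function.Injective (enc (d := d)) := by
  rintro ⟨θ, hθ, h0⟩ ⟨τ, hτ, h0'⟩ h
  obtain ⟨hn, hs⟩ := aux_sigma _ _ (fun k => (θ ^ (k + 1)) 0 - (θ ^ k) 0)
    (fun k => (τ ^ (k + 1)) 0 - (τ ^ k) 0) h
  have hp := aux_pow_eq θ τ _ hs
  apply Subtype.ext
  apply Equiv.ext
  intro x
  by_cases hx : x ∈ psupp θ
  · exact aux_agree θ τ hθ h0 hp x hx
  by_cases hx' : x ∈ psupp τ
  · exact (aux_agree τ θ hτ h0' (fun k hk => (hp k (hk.trans hn.ge)).symm) x hx').symm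
  · simp only [psupp, Set.mem_ofPred_eq, not_not] at hx hx'
    exact hx.trans hx'.symm

end cyc

theorem aux_ncard {d : ℕ} (θ : Equiv.Perm (Fin d → ℤ)) (h : IsFiniteCycle θ)
    (h0 : (0 : Fin d → ℤ) ∈ psupp θ) : (psupp θ).ncard ≠ 1 := by
  intro h1
  obtain ⟨a, ha⟩ := Set.ncard_eq_one.1 h1
  have h2 : θ 0 ∈ psupp θ := by
    simp only [psupp, Set.mem_ofPred_eq] at h0 ⊢
    exact fun h => h0 (θ.injective h)
  have h3 := h0
  rw [ha] at h2 h3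
  simp only [Set.mem_singleton_iff] at h2 h3
  exact h0 (h2.trans h3.symm)

/-- Explicit bound on the critical temperature for the Gaussian potential: for every
`α > π ((1+ρ₀)^{1/d} − 1)^{−2}`, where `ρ₀ ∈ (0,1)` solves `ρ₀/(1−ρ₀)² − ρ₀ = 1`,
one has `β(‖·‖², α) < 1`. -/
theorem gaussian_beta_lt_one_of_explicit_bound (d : ℕ) (hd : 1 ≤ d)
    (ρ₀ : ℝ) (h₀ : ρ₀ ∈ Set.Ioo (0 : ℝ) 1) (heq : ρ₀ / (1 - ρ₀) ^ 2 - ρ₀ = 1)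
    (α : ℝ) (hα : Real.pi / ((1 + ρ₀) ^ ((1 : ℝ) / d) - 1) ^ 2 < α) :
    beta (fun z : Fin d → ℤ => ∑ i, ((z i : ℝ)) ^ 2) α < 1 := by
  refine lt_of_le_of_lt ?_ (aux_series _ ρ₀ h₀ heq (aux_phi_lt d hd ρ₀ h₀ α hα))
  calc _ = ∑' θ : {θ : Equiv.Perm (Fin d → ℤ) // IsFiniteCycle θ ∧ (0 : Fin d → ℤ) ∈ psupp θ},
        (fun p : Σ n : ℕ, (Fin n → (Fin d → ℤ)) =>
          if p.1 = 1 then 0 else (p.1 : ℝ≥0∞) * ∏ k, stepW α (p.2 k)) (enc θ) := by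
        rw [beta]
        apply tsum_congr
        rintro ⟨θ, hθ, h0⟩
        rw [aux_weight α θ hθ h0]
        exact (if_neg (aux_ncard θ hθ h0)).symm
    _ ≤ ∑' p : Σ n : ℕ, (Fin n → (Fin d → ℤ)),
          (if p.1 = 1 then 0 else (p.1 : ℝ≥0∞) * ∏ k, stepW α (p.2 k)) :=
        ENNReal.tsum_comp_le_tsum_of_injective enc_injective
          (fun p => if p.1 = 1 then 0 else (p.1 : ℝ≥0∞) * ∏ k, stepW α (p.2 k))
    _ = _ := by
        rw [ENNReal.tsum_sigma']
        apply tsum_congr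
        intro n
        split_ifs with hn
        · simp
        · dsimp only
          rw [ENNReal.tsum_mul_left, aux_tsum_pow]
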